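/- Let d ≥ 1 and J ≥ 1 be integers. Then Σ_{j=1}^{J} 2^{2d−j} · exp(−4d · 2^{2(J−j−1)/d}) ≤ 2 · 2^{2d−J} · exp(−4d · 2^{−2/d}); that is, the sum is bounded by twice its final term (at j = J). -/

import Mathlib

open MeasureTheory Real
open scoped ENNReal

noncomputable section

/-- The generating measure `Q` on the circle `ℝ/ℤ` of the random walk generated by the
`d`-tuple `α`: mass `1/(2d)` at each point `α j mod 1` and `-α j mod 1`. -/
def circleQ {d : ℕ} (α : Fin d → ℝ) : Measure (AddCircle (1 : ℝ)) :=
  ((2 * d : ℝ≥0∞))⁻¹ •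
    ∑ j : Fin d, (Measure.dirac ((α j : ℝ) : AddCircle (1 : ℝ)) +
      Measure.dirac (((-(α j) : ℝ)) : AddCircle (1 : ℝ)))

/-- `k`-fold convolution power of a measure on the circle. -/
def convPow (μ : Measure (AddCircle (1 : ℝ))) : ℕ → Measure (AddCircle (1 : ℝ))
  | 0 => Measure.dirac 0
  | k + 1 => (convPow μ k).conv μ

/-- The discrepancy of a measure `P` on the circle: the supremum over all arcs
(connected subsets) `I` of `|P(I) - λ(I)|`, where `λ` is Haar (Lebesgue) probability
measure (`volume` on `AddCircle 1`). -/
def discrepancy (P : Measure (AddCircle (1 : ℝ))) : ℝ :=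
  sSup { r : ℝ | ∃ I : Set (AddCircle (1 : ℝ)), IsConnected I ∧
    r = |(P I).toReal - (volume I).toReal| }

/-- The `m`-th Fourier coefficient of a measure on the circle: `∫ e^{-2πimx} dP(x)`. -/
def fourierCoeffMeasure (P : Measure (AddCircle (1 : ℝ))) (m : ℤ) : ℂ :=
  ∫ x, fourier (-m) x ∂P

/-- Euclidean distance from `x ∈ ℝ^d` to the nearest integer lattice point. -/
def latticeDist {d : ℕ} (x : Fin d → ℝ) : ℝ :=
  ⨅ v : Fin d → ℤ, Real.sqrt (∑ i, (x i - v i) ^ 2)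

theorem sum_Icc_one_two_pow_le (J : ℕ) :
    ∑ j ∈ Finset.Icc 1 J, (2 : ℝ) ^ j ≤ 2 * 2 ^ J := by
  induction J with
  | zero => simp
  | succ n ih =>
    rw [Finset.sum_Icc_succ_top (by omega), pow_succ]
    linarith

/-- Going `x` steps back from the last term shrinks the exponential factor by at least `4 ^ x`. -/
theorem two_mul_log_two_mul_le {d x : ℝ} (hd : 1 ≤ d) (hx : 0 ≤ x) :
    2 * Real.log 2 * x ≤
      4 * d * ((2 : ℝ) ^ (2 * (x - 1) / d) - (2 : ℝ) ^ (-(2 : ℝ) / d)) := by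
  have hd0 : 0 < d := by linarith
  have hA : (1 / 4 : ℝ) ≤ (2 : ℝ) ^ (-(2 : ℝ) / d) := by
    have h : (2 : ℝ) ^ (-(2 : ℝ)) ≤ (2 : ℝ) ^ (-(2 : ℝ) / d) := by
      apply Real.rpow_le_rpow_of_exponent_le one_le_two
      rw [le_div_iff₀ hd0]
      linarith
    have h4 : (2 : ℝ) ^ (-(2 : ℝ)) = 1 / 4 := by
      rw [Real.rpow_neg two_pos.le]
      norm_num
    linarith
  have hsplit : (2 : ℝ) ^ (2 * (x - 1) / d) =
      (2 : ℝ) ^ (-(2 : ℝ) / d) * (2 : ℝ) ^ (2 * x / d) := by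
    rw [← Real.rpow_add two_pos]
    congr 1
    ring
  have ht : Real.log 2 * (2 * x / d) ≤ (2 : ℝ) ^ (2 * x / d) - 1 := by
    rw [Real.rpow_def_of_pos two_pos]
    linarith [Real.add_one_le_exp (Real.log 2 * (2 * x / d))]
  have ht0 : 0 ≤ Real.log 2 * (2 * x / d) :=
    mul_nonneg (Real.log_nonneg one_le_two) (by positivity)
  calc 2 * Real.log 2 * x = 4 * d * (1 / 4 * (Real.log 2 * (2 * x / d))) := by field_simp
    _ ≤ 4 * d * ((2 : ℝ) ^ (-(2 : ℝ) / d) * ((2 : ℝ) ^ (2 * x / d) - 1)) := by gcongr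
    _ = _ := by rw [hsplit]; ring

/-- The sum over a dyadic range is bounded by twice its final term (at `j = J`). -/
theorem sum_le_twice_last_term
    (d J : ℕ) (hd : 1 ≤ d) (hJ : 1 ≤ J) :
    ∑ j ∈ Finset.Icc 1 J, (2 : ℝ) ^ (2 * (d : ℝ) - j) *
        Real.exp (-(4 * d * (2 : ℝ) ^ (2 * ((J : ℝ) - j - 1) / d))) ≤
      2 * (2 : ℝ) ^ (2 * (d : ℝ) - J) *
        Real.exp (-(4 * d * (2 : ℝ) ^ (-(2 : ℝ) / d))) := by
  have hterm : ∀ j ∈ Finset.Icc 1 J, (2 : ℝ) ^ (2 * (d : ℝ) - j) *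
        Real.exp (-(4 * d * (2 : ℝ) ^ (2 * ((J : ℝ) - j - 1) / d))) ≤
      (2 : ℝ) ^ j * ((2 : ℝ) ^ (-(J : ℝ)) * ((2 : ℝ) ^ (2 * (d : ℝ) - J) *
        Real.exp (-(4 * d * (2 : ℝ) ^ (-(2 : ℝ) / d))))) := by
    intro j hj
    have hjJ : (j : ℝ) ≤ J := by exact_mod_cast (Finset.mem_Icc.mp hj).2
    have key := two_mul_log_two_mul_le (d := d) (x := (J : ℝ) - j)
      (by exact_mod_cast hd) (sub_nonneg.mpr hjJ)
    rw [← Real.rpow_natCast 2 j, Real.rpow_def_of_pos two_pos (2 * (d : ℝ) - j),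
      Real.rpow_def_of_pos two_pos (j : ℝ), Real.rpow_def_of_pos two_pos (-(J : ℝ)),
      Real.rpow_def_of_pos two_pos (2 * (d : ℝ) - J), ← Real.exp_add, ← Real.exp_add,
      ← Real.exp_add, ← Real.exp_add, Real.exp_le_exp]
    linarith
  refine (Finset.sum_le_sum hterm).trans ?_
  rw [← Finset.sum_mul]
  refine (mul_le_mul_of_nonneg_right (sum_Icc_one_two_pow_le J) (by positivity)).trans_eq ?_
  rw [Real.rpow_neg two_pos.le, Real.rpow_natCast]
  field_simp

end
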